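/- Light-cone metric components of W₃ gravity (Eq. 3.38): Let Ω ⊆ ℝ² be open with coordinates (z,t), and let f^A : Ω → ℂ for A = 0,1,2 be C³ functions satisfying ∂_t f^A = ∂_z² f^A and ∂_z∂_t f^A = L·∂_t f^A + M·∂_z f^A on Ω, where L, M : Ω → ℂ are differentiable in z. Fix ḡ^0, ḡ^1, ḡ^2 ∈ ℂ and set S := Σ_A f^A ḡ^A. At every point of Ω where S ≠ 0, define ū¹ := (Σ_A ∂_z f^A ḡ^A)/S, ū² := (Σ_A ∂_t f^A ḡ^A)/S, and h_{ℓm} := −(Σ_A ∂_ℓ∂_m f^A ḡ^A)/S + ū^ℓ ū^m for ℓ,m ∈ {1,2}, with ∂_1 = ∂_z and ∂_2 = ∂_t. Then at such points: h_{11} = −ū² + (ū¹)², h_{12} = −L·ū² − M·ū¹ + ū¹ū², and h_{22} = −(∂_z L + L² + M)·ū² − (∂_z M + L·M)·ū¹ + (ū²)². -/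

import Mathlib

/-- Partial derivative in the `z` direction of a function on `ℝ² = {(z,t)}`. -/
noncomputable def Dz (g : ℝ × ℝ → ℂ) (p : ℝ × ℝ) : ℂ := fderiv ℝ g p (1, 0)

/-- Partial derivative in the `t` direction of a function on `ℝ² = {(z,t)}`. -/
noncomputable def Dt (g : ℝ × ℝ → ℂ) (p : ℝ × ℝ) : ℂ := fderiv ℝ g p (0, 1)

lemma ContDiffAt.Dz_right {m n : WithTop ℕ∞} {g : ℝ × ℝ → ℂ} {p : ℝ × ℝ}
    (hg : ContDiffAt ℝ n g p) (hmn : m + 1 ≤ n) : ContDiffAt ℝ m (Dz g) p :=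
  (hg.fderiv_right hmn).clm_apply contDiffAt_const

lemma ContDiffAt.Dt_right {m n : WithTop ℕ∞} {g : ℝ × ℝ → ℂ} {p : ℝ × ℝ}
    (hg : ContDiffAt ℝ n g p) (hmn : m + 1 ≤ n) : ContDiffAt ℝ m (Dt g) p :=
  (hg.fderiv_right hmn).clm_apply contDiffAt_const

/-- Mixed partial derivatives of a `C²` function commute. -/
lemma Dt_Dz_comm {g : ℝ × ℝ → ℂ} {p : ℝ × ℝ} (hg : ContDiffAt ℝ 2 g p) :
    Dt (Dz g) p = Dz (Dt g) p := by
  have hd : DifferentiableAt ℝ (fderiv ℝ g) p :=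
    (hg.fderiv_right (m := 1) (by norm_num)).differentiableAt (by norm_num)
  have key (v w : ℝ × ℝ) :
      fderiv ℝ (fun q => fderiv ℝ g q v) p w = fderiv ℝ (fderiv ℝ g) p w v := by
    rw [fderiv_clm_apply hd (differentiableAt_const v)]
    simp
  have hs : IsSymmSndFDerivAt ℝ g p := hg.isSymmSndFDerivAt (by simp)
  exact (key _ _).trans ((hs.eq _ _).trans (key _ _).symm)

lemma Dz_congr {g h : ℝ × ℝ → ℂ} {p : ℝ × ℝ} {Ω : Set (ℝ × ℝ)} (hΩ : IsOpen Ω) (hp : p ∈ Ω)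
    (hgh : ∀ q ∈ Ω, g q = h q) : Dz g p = Dz h p := by
  unfold Dz
  rw [Filter.EventuallyEq.fderiv_eq (Filter.eventuallyEq_of_mem (hΩ.mem_nhds hp) hgh)]

lemma Dt_congr {g h : ℝ × ℝ → ℂ} {p : ℝ × ℝ} {Ω : Set (ℝ × ℝ)} (hΩ : IsOpen Ω) (hp : p ∈ Ω)
    (hgh : ∀ q ∈ Ω, g q = h q) : Dt g p = Dt h p := by
  unfold Dt
  rw [Filter.EventuallyEq.fderiv_eq (Filter.eventuallyEq_of_mem (hΩ.mem_nhds hp) hgh)]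

lemma hasLineDerivAt_Dz {g : ℝ × ℝ → ℂ} {p : ℝ × ℝ} (hg : DifferentiableAt ℝ g p) :
    HasLineDerivAt ℝ g (Dz g p) p (1, 0) :=
  hg.hasFDerivAt.hasLineDerivAt (1, 0)

/-- The product rule for line derivatives. -/
lemma HasLineDerivAt.mul_complex {E : Type*} [AddCommGroup E] [Module ℝ E] {g h : E → ℂ}
    {g' h' : ℂ} {p v : E} (hg : HasLineDerivAt ℝ g g' p v) (hh : HasLineDerivAt ℝ h h' p v) :
    HasLineDerivAt ℝ (fun q => g q * h q) (g' * h p + g p * h') p v := by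
  have := HasDerivAt.mul hg hh
  simp only [zero_smul, add_zero] at this
  exact this

/-- The second `t`-derivative of a solution, reduced to its first derivatives. -/
lemma Dt_Dt_eq {Ω : Set (ℝ × ℝ)} (hΩ : IsOpen Ω) {f L M : ℝ × ℝ → ℂ} (hf : ContDiffOn ℝ 3 f Ω)
    (heq1 : ∀ p ∈ Ω, Dt f p = Dz (Dz f) p)
    (heq2 : ∀ p ∈ Ω, Dz (Dt f) p = L p * Dt f p + M p * Dz f p) {p : ℝ × ℝ} (hp : p ∈ Ω)
    (hL : LineDifferentiableAt ℝ L p (1, 0)) (hM : LineDifferentiableAt ℝ M p (1, 0)) :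
    Dt (Dt f) p = (lineDeriv ℝ L p (1, 0) + L p ^ 2 + M p) * Dt f p
      + (lineDeriv ℝ M p (1, 0) + L p * M p) * Dz f p := by
  have hfA : ∀ q ∈ Ω, ContDiffAt ℝ 3 f q := fun q hq => hf.contDiffAt (hΩ.mem_nhds hq)
  have hz : ContDiffAt ℝ 2 (Dz f) p := (hfA p hp).Dz_right (by norm_num)
  have ht : ContDiffAt ℝ 2 (Dt f) p := (hfA p hp).Dt_right (by norm_num)
  have hzt : ContDiffAt ℝ 1 (Dz (Dt f)) p := ht.Dz_right (by norm_num)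
  have hprod : HasLineDerivAt ℝ (fun q => L q * Dt f q + M q * Dz f q) _ p (1, 0) :=
    HasDerivAt.add
      (hL.hasLineDerivAt.mul_complex (hasLineDerivAt_Dz (ht.differentiableAt (by norm_num))))
      (hM.hasLineDerivAt.mul_complex (hasLineDerivAt_Dz (hz.differentiableAt (by norm_num))))
  have hderiv := (hasLineDerivAt_Dz (hzt.differentiableAt (by norm_num))).congr_of_eventuallyEq
    (Filter.eventuallyEq_of_mem (hΩ.mem_nhds hp) fun q hq => (heq2 q hq).symm)
  calc Dt (Dt f) p = Dt (Dz (Dz f)) p := Dt_congr hΩ hp heq1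
    _ = Dz (Dt (Dz f)) p := Dt_Dz_comm hz
    _ = Dz (Dz (Dt f)) p :=
      Dz_congr hΩ hp fun q hq => Dt_Dz_comm ((hfA q hq).of_le (by norm_num))
    _ = _ := hderiv.unique hprod
    _ = _ := by rw [← heq1 p hp, heq2 p hp]; ring

/-- **Light-cone metric components of `W₃` gravity (Eq. 3.38).**
With `∂_t f^A = ∂_z² f^A`, `∂_z∂_t f^A = L ∂_t f^A + M ∂_z f^A`, `S = ∑ f^A ḡ^A ≠ 0`,
`ū¹ = (∑ ∂_z f^A ḡ^A)/S`, `ū² = (∑ ∂_t f^A ḡ^A)/S` and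
`h_{ℓm} = −(∑ ∂_ℓ∂_m f^A ḡ^A)/S + ūℓūm`, one gets
`h₁₁ = −ū² + (ū¹)²`, `h₁₂ = −L ū² − M ū¹ + ū¹ū²`,
`h₂₂ = −(∂_z L + L² + M) ū² − (∂_z M + L M) ū¹ + (ū²)²`. -/
theorem stmt_14 (Ω : Set (ℝ × ℝ)) (hΩ : IsOpen Ω) (f : Fin 3 → ℝ × ℝ → ℂ)
    (L M : ℝ × ℝ → ℂ) (gbar : Fin 3 → ℂ)
    (hf : ∀ A, ContDiffOn ℝ 3 (f A) Ω)
    (hL : ∀ p ∈ Ω, LineDifferentiableAt ℝ L p (1, 0))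
    (hM : ∀ p ∈ Ω, LineDifferentiableAt ℝ M p (1, 0))
    (heq1 : ∀ A, ∀ p ∈ Ω, Dt (f A) p = Dz (fun q => Dz (f A) q) p)
    (heq2 : ∀ A, ∀ p ∈ Ω,
      Dz (fun q => Dt (f A) q) p = L p * Dt (f A) p + M p * Dz (f A) p) :
    ∀ p ∈ Ω, ∀ S u1 u2 : ℂ,
      S = ∑ A, f A p * gbar A → S ≠ 0 →
      u1 = (∑ A, Dz (f A) p * gbar A) / S →
      u2 = (∑ A, Dt (f A) p * gbar A) / S →
      (-(∑ A, Dz (fun q => Dz (f A) q) p * gbar A) / S + u1 * u1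
          = -u2 + u1 ^ 2) ∧
      (-(∑ A, Dz (fun q => Dt (f A) q) p * gbar A) / S + u1 * u2
          = -(L p) * u2 - M p * u1 + u1 * u2) ∧
      (-(∑ A, Dt (fun q => Dt (f A) q) p * gbar A) / S + u2 * u2
          = -(lineDeriv ℝ L p (1, 0) + L p ^ 2 + M p) * u2
            - (lineDeriv ℝ M p (1, 0) + L p * M p) * u1 + u2 ^ 2) := by
  intro p hp S u1 u2 _ _ hu1 hu2
  have h22 (A : Fin 3) := Dt_Dt_eq hΩ (hf A) (heq1 A) (heq2 A) hp (hL p hp) (hM p hp)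
  refine ⟨?_, ?_, ?_⟩
  · simp only [← heq1 _ p hp, hu1, hu2]
    ring
  · simp only [heq2 _ p hp, hu1, hu2, Fin.sum_univ_three]
    ring
  · simp only [h22, hu1, hu2, Fin.sum_univ_three]
    ring
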